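/- Let ω > 0 and ε > 0, and let (xₙ) be a real sequence satisfying x_{n+1} − 2·cos(ωε)·xₙ + x_{n−1} = 0 for all n. Define E⁽⁰⁾ₙ = x_{n+1}² − 2·cos(ωε)·xₙ·x_{n+1} + xₙ², E⁽¹⁾ₙ = ½·((x_{n+1} − xₙ)/((2/ω)·sin(ωε/2)))² + ½·ω²·xₙ·x_{n+1}, and E⁽²⁾ₙ = ½·(ω·(x_{n+1} − xₙ·cos(ωε))/sin(ωε))² + ½·ω²·xₙ² (assuming sin(ωε/2) ≠ 0, respectively sin(ωε) ≠ 0, where these appear in denominators). Then E⁽ᵏ⁾_{n+1} = E⁽ᵏ⁾ₙ for k = 0, 1, 2 and all n, and moreover E⁽¹⁾ₙ = ½·(ω/(2·sin(ωε/2)))²·E⁽⁰⁾ₙ and E⁽²⁾ₙ = (1 + tan²(ωε/2))·E⁽¹⁾ₙ = ½·(ω/sin(ωε))²·E⁽⁰⁾ₙ. -/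

import Mathlib

/-- Discrete analogues of the energy integral for the exact discretization
`x_{n+1} - 2 cos(ωε) xₙ + x_{n-1} = 0` of the harmonic oscillator:
the three quantities `E⁽⁰⁾ₙ`, `E⁽¹⁾ₙ`, `E⁽²⁾ₙ` are conserved, and they satisfy
`E⁽¹⁾ₙ = ½(ω/(2 sin(ωε/2)))² E⁽⁰⁾ₙ`,
`E⁽²⁾ₙ = (1 + tan²(ωε/2)) E⁽¹⁾ₙ = ½(ω/sin ωε)² E⁽⁰⁾ₙ`. -/
theorem discrete_energy_integrals_harmonic_oscillator
    (ω ε : ℝ) (hω : 0 < ω) (hε : 0 < ε)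
    (hs2 : Real.sin (ω * ε / 2) ≠ 0) (hs : Real.sin (ω * ε) ≠ 0)
    (x : ℤ → ℝ)
    (hrec : ∀ n : ℤ, x (n + 1) - 2 * Real.cos (ω * ε) * x n + x (n - 1) = 0)
    (E0 E1 E2 : ℤ → ℝ)
    (hE0 : ∀ n : ℤ, E0 n
      = (x (n + 1)) ^ 2 - 2 * Real.cos (ω * ε) * x n * x (n + 1) + (x n) ^ 2)
    (hE1 : ∀ n : ℤ, E1 n
      = (1 / 2) * ((x (n + 1) - x n) / ((2 / ω) * Real.sin (ω * ε / 2))) ^ 2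
        + (1 / 2) * ω ^ 2 * x n * x (n + 1))
    (hE2 : ∀ n : ℤ, E2 n
      = (1 / 2) * (ω * (x (n + 1) - x n * Real.cos (ω * ε)) / Real.sin (ω * ε)) ^ 2
        + (1 / 2) * ω ^ 2 * (x n) ^ 2) :
    (∀ n : ℤ, E0 (n + 1) = E0 n) ∧
    (∀ n : ℤ, E1 (n + 1) = E1 n) ∧
    (∀ n : ℤ, E2 (n + 1) = E2 n) ∧
    (∀ n : ℤ, E1 n = (1 / 2) * (ω / (2 * Real.sin (ω * ε / 2))) ^ 2 * E0 n) ∧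
    (∀ n : ℤ, E2 n = (1 + Real.tan (ω * ε / 2) ^ 2) * E1 n) ∧
    (∀ n : ℤ, E2 n = (1 / 2) * (ω / Real.sin (ω * ε)) ^ 2 * E0 n) := by
  have hdS : Real.sin (ω * ε) = 2 * Real.sin (ω * ε / 2) * Real.cos (ω * ε / 2) := by
    rw [← Real.sin_two_mul]; congr 1; ring
  have hdC : Real.cos (ω * ε) = 1 - 2 * Real.sin (ω * ε / 2) ^ 2 := by
    have h1 := Real.cos_two_mul (ω * ε / 2)
    have h2 := Real.sin_sq_add_cos_sq (ω * ε / 2)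
    have h3 : 2 * (ω * ε / 2) = ω * ε := by ring
    rw [h3] at h1
    linarith
  have hc2 : Real.cos (ω * ε / 2) ≠ 0 := by
    intro h
    exact hs (by rw [hdS, h, mul_zero])
  have hω' : ω ≠ 0 := hω.ne'
  have c0 : ∀ n : ℤ, E0 (n + 1) = E0 n := by
    intro n
    have h := hrec (n + 1)
    rw [add_sub_cancel_right] at h
    rw [hE0, hE0]
    linear_combination (x (n + 1 + 1) - x n) * h
  have r1 : ∀ n : ℤ, E1 n = (1 / 2) * (ω / (2 * Real.sin (ω * ε / 2))) ^ 2 * E0 n := by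
    intro n
    rw [hE1, hE0, hdC]
    field_simp
    ring
  have r2 : ∀ n : ℤ, E2 n = (1 / 2) * (ω / Real.sin (ω * ε)) ^ 2 * E0 n := by
    intro n
    have h2 := Real.sin_sq_add_cos_sq (ω * ε)
    rw [hE2, hE0]
    field_simp
    linear_combination (x n) ^ 2 * h2
  refine ⟨c0, ?_, ?_, r1, ?_, r2⟩
  · intro n
    rw [r1, r1, c0]
  · intro n
    rw [r2, r2, c0]
  · intro n
    have h2 := Real.sin_sq_add_cos_sq (ω * ε / 2)
    have ht : 1 + Real.tan (ω * ε / 2) ^ 2 = 1 / Real.cos (ω * ε / 2) ^ 2 := by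
      rw [Real.tan_eq_sin_div_cos]
      field_simp
      linarith
    rw [r2, r1, ht, hdS]
    field_simp
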